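/- arXiv:0905.1342 — 5 statements merged into one kernel-verified Lean document; each statement's English description precedes it below -/
import Mathlib

section
/- Let G be a finite group and let A, B, D be conjugacy classes of G such that AB = D. Then C_G(A) ∩ C_G(B) is a normal subgroup of C_G(D) and the quotient C_G(D)/(C_G(A) ∩ C_G(B)) is an abelian group. -/
open scoped Pointwise

namespace Subgroup

variable {G : Type*} [Group G]

/-- The centralizer of a conjugation-invariant set is normal. -/
theorem centralizer_normal_of_conj_mem {S : Set G}
    (hS : ∀ s ∈ S, ∀ g : G, g⁻¹ * s * g ∈ S) : (centralizer S).Normal where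
  conj_mem c hc g := by
    rw [mem_centralizer_iff] at hc ⊢
    intro s hs
    have h := hc _ (hS s hs g)
    calc s * (g * c * g⁻¹) = g * (g⁻¹ * s * g * c) * g⁻¹ := by group
      _ = g * c * g⁻¹ * s := by rw [h]; group

/-- If each `c` in a normal subgroup `C` acts on a conjugation-invariant set `S` by right
multiplication by a constant, then the action of `C` on `S` is commutative. -/
theorem conj_mul_comm_of_conj_eq_mul {S : Set G} {C : Subgroup G} [hC : C.Normal]
    (hS : ∀ s ∈ S, ∀ g : G, g⁻¹ * s * g ∈ S)
    (h : ∀ c ∈ C, ∃ z : G, ∀ s ∈ S, c⁻¹ * s * c = s * z)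
    {x y s : G} (hx : x ∈ C) (hy : y ∈ C) (hs : s ∈ S) :
    (x * y)⁻¹ * s * (x * y) = (y * x)⁻¹ * s * (y * x) := by
  obtain ⟨z, hz⟩ := h x hx
  obtain ⟨t, ht⟩ := h y hy
  have hzC : z ∈ C := by
    have hz' : z = s⁻¹ * x⁻¹ * s * x := by
      calc z = s⁻¹ * (s * z) := by group
        _ = _ := by rw [← hz s hs]; group
    rw [hz']
    have := hC.conj_mem _ (C.inv_mem hx) s⁻¹
    rw [inv_inv] at this
    exact C.mul_mem this hx
  have comm : ∀ v ∈ C, v * t = t * v := by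
    intro v hv
    have hw : s * v * s⁻¹ ∈ C := hC.conj_mem v hv s
    obtain ⟨u, hu⟩ := h _ hw
    have h₁ := hu s hs
    have h₂ := hu (s * t) (ht s hs ▸ hS s hs y)
    have hu' : u = v⁻¹ * (s * v * s⁻¹) := by
      calc u = s⁻¹ * (s * u) := by group
        _ = _ := by rw [← h₁]; group
    rw [hu'] at h₂
    have h₃ : v⁻¹ * t = t * v⁻¹ := by
      calc v⁻¹ * t = s⁻¹ * ((s * v * s⁻¹)⁻¹ * (s * t) * (s * v * s⁻¹)) * (s * v * s⁻¹)⁻¹ := by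
            group
        _ = t * v⁻¹ := by rw [h₂]; group
    calc v * t = v * (t * v⁻¹) * v := by group
      _ = t * v := by rw [← h₃]; group
  calc (x * y)⁻¹ * s * (x * y) = y⁻¹ * (x⁻¹ * s * x) * y := by group
    _ = s * z * t := by rw [ht _ (hS s hs x), hz s hs]
    _ = s * t * z := by rw [mul_assoc, comm z hzC, mul_assoc]
    _ = x⁻¹ * (y⁻¹ * s * y) * x := by rw [hz _ (hS s hs y), ht s hs]
    _ = (y * x)⁻¹ * s * (y * x) := by group

end Subgroup


/-- If `A`, `B`, `D` are conjugacy classes of a finite group `G` with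
`AB = D`, then `C_G(A) ∩ C_G(B)` is a normal subgroup of `C_G(D)` and the quotient
`C_G(D)/(C_G(A) ∩ C_G(B))` is abelian. -/
theorem stmt_1 {G : Type*} [Group G] [Finite G] (A B D : Set G)
    (hA : ∃ a : G, A = {x | IsConj a x})
    (hB : ∃ b : G, B = {x | IsConj b x})
    (hD : ∃ d : G, D = {x | IsConj d x})
    (hAB : A * B = D) :
    Subgroup.centralizer A ⊓ Subgroup.centralizer B ≤ Subgroup.centralizer D ∧
    ∃ _ : ((Subgroup.centralizer A ⊓ Subgroup.centralizer B).subgroupOf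
        (Subgroup.centralizer D)).Normal,
      ∀ x y : ↥(Subgroup.centralizer D) ⧸
          ((Subgroup.centralizer A ⊓ Subgroup.centralizer B).subgroupOf
            (Subgroup.centralizer D)),
        x * y = y * x := by
  have inv : ∀ S : Set G, (∃ a : G, S = {x | IsConj a x}) →
      ∀ s ∈ S, ∀ g : G, g⁻¹ * s * g ∈ S := by
    rintro _ ⟨a, rfl⟩ s hs g
    exact IsConj.trans hs (isConj_iff.2 ⟨g⁻¹, by simp⟩)
  have hA' := inv A hA
  have hB' := inv B hB
  have nA := Subgroup.centralizer_normal_of_conj_mem hA'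
  have nB := Subgroup.centralizer_normal_of_conj_mem hB'
  have nD := Subgroup.centralizer_normal_of_conj_mem (inv D hD)
  have conj_eq : ∀ c ∈ Subgroup.centralizer D, ∀ a ∈ A, ∀ b ∈ B,
      c⁻¹ * a * c = a * (b * (c⁻¹ * b * c)⁻¹) := by
    intro c hc a ha b hb
    have h : a * b * c = c * (a * b) :=
      Subgroup.mem_centralizer_iff.1 hc _ (hAB ▸ Set.mul_mem_mul ha hb)
    calc c⁻¹ * a * c = c⁻¹ * (a * b * c) * (c⁻¹ * b * c)⁻¹ := by group
      _ = _ := by rw [h]; group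
  obtain ⟨a₀, ha₀⟩ : A.Nonempty := by
    obtain ⟨a, rfl⟩ := hA
    exact ⟨a, IsConj.refl a⟩
  obtain ⟨b₀, hb₀⟩ : B.Nonempty := by
    obtain ⟨b, rfl⟩ := hB
    exact ⟨b, IsConj.refl b⟩
  refine ⟨?_, inferInstance, ?_⟩
  · rintro c ⟨hcA, hcB⟩
    rw [Subgroup.mem_centralizer_iff, ← hAB]
    rintro _ ⟨a, ha, b, hb, rfl⟩
    have h₁ : Commute a c := Subgroup.mem_centralizer_iff.1 hcA a ha
    have h₂ : Commute b c := Subgroup.mem_centralizer_iff.1 hcB b hb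
    exact h₁.mul_left h₂
  · intro x y
    induction x using QuotientGroup.induction_on with | _ x
    induction y using QuotientGroup.induction_on with | _ y
    rw [← QuotientGroup.mk_mul, ← QuotientGroup.mk_mul, QuotientGroup.eq,
      Subgroup.mem_subgroupOf]
    set c := (x * y)⁻¹ * (y * x) with hc
    have hcA : ∀ a ∈ A, a * (c : G) = c * a := by
      intro a ha
      have h := Subgroup.conj_mul_comm_of_conj_eq_mul hA'
        (fun c hc => ⟨_, fun s hs => conj_eq c hc s hs b₀ hb₀⟩)
        x⁻¹.2 y⁻¹.2 ha
      push_cast [hc] at h ⊢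
      calc a * (((x : G) * y)⁻¹ * (y * x))
          = ((x : G) * y)⁻¹ * (((y : G)⁻¹ * (x : G)⁻¹)⁻¹ * a * ((y : G)⁻¹ * (x : G)⁻¹))
            * (y * x) := by group
        _ = ((x : G) * y)⁻¹ * (y * x) * a := by rw [← h]; group
    refine ⟨Subgroup.mem_centralizer_iff.2 hcA, Subgroup.mem_centralizer_iff.2 fun b hb => ?_⟩
    have h := conj_eq c c.2 a₀ ha₀ b hb
    rw [mul_assoc, hcA a₀ ha₀, inv_mul_cancel_left, left_eq_mul, mul_inv_eq_one] at h
    calc b * (c : G) = (c * ((c : G)⁻¹ * b * c)) := by group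
      _ = c * b := by rw [← h]
end

section
/- Let G be a finite supersolvable group and let A, B, D be conjugacy classes of G such that D ⊆ AB. Then the quotient group C_G(D)/(C_G(A) ∩ C_G(B)) is solvable of derived length at most 2·η(AB); that is, the 2·η(AB)-th term of the derived series of C_G(D) is contained in C_G(A) ∩ C_G(B). -/
open scoped Pointwise

/-- The conjugacy class of `a` in `G`. -/
def conjClass {G : Type*} [Group G] (a : G) : Set G := {x | IsConj a x}

/-- `η(X)`: the number of distinct conjugacy classes of `G` contained in `X`. -/
noncomputable def eta {G : Type*} [Group G] (X : Set G) : ℕ :=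
  Nat.card {C : Set G // (∃ a : G, C = conjClass a) ∧ C ⊆ X}

/-- A group is supersolvable if it has a chain of subgroups from `⊥` to `⊤`, each
normal in the whole group, with all successive quotients cyclic. -/
def IsSupersolvable (G : Type*) [Group G] : Prop :=
  ∃ (n : ℕ) (H : ℕ → Subgroup G),
    H 0 = ⊥ ∧ H n = ⊤ ∧ (∀ i, H i ≤ H (i + 1)) ∧ (∀ i, (H i).Normal) ∧
    ∀ i, ∀ _ : ((H i).subgroupOf (H (i + 1))).Normal,
      IsCyclic (↥(H (i + 1)) ⧸ (H i).subgroupOf (H (i + 1)))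

open scoped commutatorElement

/-- The commutator subgroup acts trivially by conjugation on every normal subgroup `T` that is
cyclic modulo `M`. -/
lemma commutator_commutator_le_of_isCyclic {G : Type*} [Group G] {M T : Subgroup G} [M.Normal]
    [T.Normal] [IsCyclic (T ⧸ M.subgroupOf T)] : ⁅commutator G, T⁆ ≤ M := by
  obtain ⟨q, hq⟩ := IsCyclic.exists_generator (α := T ⧸ M.subgroupOf T)
  obtain ⟨t, rfl⟩ := QuotientGroup.mk_surjective q
  have key : ∀ s ∈ T, ∃ k : ℤ, (QuotientGroup.mk' M s) = (QuotientGroup.mk' M t) ^ k := by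
    intro s hs
    obtain ⟨k, hk⟩ := hq (QuotientGroup.mk (⟨s, hs⟩ : T))
    refine ⟨k, ?_⟩
    have h : ((t ^ k : T) : T ⧸ M.subgroupOf T) = ((⟨s, hs⟩ : T) : T ⧸ M.subgroupOf T) := hk
    rw [QuotientGroup.eq, Subgroup.mem_subgroupOf] at h
    rw [← map_zpow]
    symm
    change ((_ : G) : G ⧸ M) = ((_ : G) : G ⧸ M)
    rw [QuotientGroup.eq]
    simpa using h
  set π := QuotientGroup.mk' M with hπ
  -- the generator is fixed by commutators
  have fix : commutator G ≤ (Subgroup.centralizer {π t}).comap π := by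
    rw [commutator_def, Subgroup.commutator_le]
    intro g _ h _
    obtain ⟨m, hm⟩ := key _ (‹T.Normal›.conj_mem t t.2 g⁻¹)
    obtain ⟨n, hn⟩ := key _ (‹T.Normal›.conj_mem t t.2 h⁻¹)
    rw [Subgroup.mem_comap, Subgroup.mem_centralizer_singleton_iff]
    simp only [map_mul, map_inv, inv_inv, map_commutatorElement] at hm hn ⊢
    generalize π g = g at *
    generalize π h = h at *
    generalize π t = t at *
    have hgh : g⁻¹ * (h⁻¹ * t * h) * g = h⁻¹ * (g⁻¹ * t * g) * h := by
      have e1 := conj_zpow (a := g⁻¹) (b := t) (i := n)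
      have e2 := conj_zpow (a := h⁻¹) (b := t) (i := m)
      rw [inv_inv] at e1 e2
      rw [hn, hm, ← e1, ← e2, hm, hn, ← zpow_mul, ← zpow_mul, mul_comm]
    rw [commutatorElement_def]
    have e := congrArg (fun z => g * h * z * (g⁻¹ * h⁻¹)) hgh
    have e' : g * h * g⁻¹ * h⁻¹ * t * (h * g * g⁻¹ * h⁻¹) = t * (g * h * g⁻¹ * h⁻¹) := by
      simpa [mul_assoc] using e
    simpa [mul_assoc] using e'
  rw [Subgroup.commutator_le]
  intro g hg s hs
  have h1 := fix hg
  rw [Subgroup.mem_comap, Subgroup.mem_centralizer_singleton_iff] at h1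
  obtain ⟨k, hk⟩ := key s hs
  rw [← QuotientGroup.ker_mk' M, MonoidHom.mem_ker, map_commutatorElement,
    commutatorElement_eq_one_iff_mul_comm]
  change π g * π s = π s * π g
  rw [hk]
  exact (Commute.zpow_right (show Commute (π g) (π t) from h1) k).eq

/-- The elements centralizing `A` modulo the normal subgroup `T`. -/
def centralizerMod {G : Type*} [Group G] (A : Set G) (T : Subgroup G) [T.Normal] : Subgroup G :=
  (Subgroup.centralizer (QuotientGroup.mk' T '' A)).comap (QuotientGroup.mk' T)

lemma mem_centralizerMod {G : Type*} [Group G] {A : Set G} {T : Subgroup G} [T.Normal] {x : G} :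
    x ∈ centralizerMod A T ↔ ∀ a ∈ A, ⁅a, x⁆ ∈ T := by
  simp only [centralizerMod, Subgroup.mem_comap, Subgroup.mem_centralizer_iff,
    Set.forall_mem_image]
  refine forall₂_congr fun a _ => ?_
  rw [← commutatorElement_eq_one_iff_mul_comm, ← map_commutatorElement, ← MonoidHom.mem_ker,
    QuotientGroup.ker_mk']

lemma commutator_inf_centralizerMod_le {G : Type*} [Group G] (A : Set G) (L T P : Subgroup G)
    [L.Normal] [T.Normal] [P.Normal] (h : ⁅L, T⁆ ≤ P) :
    ⁅L ⊓ centralizerMod A T, L ⊓ centralizerMod A T⁆ ≤ centralizerMod A P := by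
  have comm : ∀ g ∈ L, ∀ t ∈ T,
      Commute (QuotientGroup.mk' P g) (QuotientGroup.mk' P t) := by
    intro g hg t ht
    have := h (Subgroup.commutator_mem_commutator hg ht)
    rwa [← QuotientGroup.ker_mk' P, MonoidHom.mem_ker, map_commutatorElement,
      commutatorElement_eq_one_iff_mul_comm] at this
  rw [Subgroup.commutator_le]
  intro x ⟨hxL, hx⟩ y ⟨hyL, hy⟩
  replace hx := mem_centralizerMod.mp hx
  replace hy := mem_centralizerMod.mp hy
  rw [mem_centralizerMod]
  intro a ha
  have hu := hx a ha
  have hv := hy a ha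
  have huL : ⁅a, x⁆ ∈ L := by
    rw [commutatorElement_def]
    exact L.mul_mem (‹L.Normal›.conj_mem x hxL a) (L.inv_mem hxL)
  have c1 := comm x hxL _ hu
  have c2 := comm x hxL _ hv
  have c3 := comm y hyL _ hu
  have c4 := comm y hyL _ hv
  have c5 := comm _ huL _ hv
  have ex : a * x * a⁻¹ = ⁅a, x⁆ * x := by simp [commutatorElement_def]
  have ey : a * y * a⁻¹ = ⁅a, y⁆ * y := by simp [commutatorElement_def]
  generalize ⁅a, x⁆ = u at *
  generalize ⁅a, y⁆ = v at *
  rw [← QuotientGroup.ker_mk' P, MonoidHom.mem_ker, map_commutatorElement,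
    commutatorElement_eq_one_iff_mul_comm, map_commutatorElement]
  have ex' := congrArg (QuotientGroup.mk' P) ex
  have ey' := congrArg (QuotientGroup.mk' P) ey
  simp only [map_mul, map_inv] at ex' ey'
  generalize QuotientGroup.mk' P x = x at *
  generalize QuotientGroup.mk' P y = y at *
  generalize QuotientGroup.mk' P a = a at *
  generalize QuotientGroup.mk' P u = u at *
  generalize QuotientGroup.mk' P v = v at *
  have e : a * ⁅x, y⁆ * a⁻¹ = ⁅u * x, v * y⁆ := by
    rw [← ex', ← ey']; simp only [commutatorElement_def]; group
  have e2 : ⁅u * x, v * y⁆ = ⁅x, y⁆ := by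
    have s1 : u * x * (v * y) = (u * v) * (x * y) := by
      rw [mul_assoc, ← mul_assoc x v, c2.eq]; simp only [mul_assoc]
    have s2 : v * y * (u * x) = (u * v) * (y * x) := by
      rw [mul_assoc, ← mul_assoc y u, c3.eq, c5.eq]; simp only [mul_assoc]
    have s3 : ∀ p q : G ⧸ P, ⁅p, q⁆ = p * q * (q * p)⁻¹ := by
      intro p q; simp [commutatorElement_def, mul_assoc]
    have c6 : Commute (u * v) (x * y * (y * x)⁻¹) :=
      Commute.mul_right ((c1.symm.mul_right c3.symm).mul_left (c2.symm.mul_right c4.symm))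
        ((c3.symm.mul_right c1.symm).mul_left (c4.symm.mul_right c2.symm)).inv_right
    rw [s3, s3, s1, s2, mul_inv_rev (u * v), ← mul_assoc, mul_assoc (u * v), c6.mul_inv_cancel]
  exact mul_inv_eq_iff_eq_mul.mp (e.trans e2)

/-- The derived subgroup, as an operation on the subgroups of a fixed group. -/
def derivedSubgroup {G : Type*} [Group G] (S : Subgroup G) : Subgroup G := ⁅S, S⁆

lemma derivedSubgroup_mono {G : Type*} [Group G] :
    Monotone (derivedSubgroup : Subgroup G → Subgroup G) :=
  fun _ _ h => Subgroup.commutator_mono h h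

lemma derivedSubgroup_le {G : Type*} [Group G] (S : Subgroup G) : derivedSubgroup S ≤ S :=
  Subgroup.commutator_le_self S

lemma map_subtype_derivedSeries {G : Type*} [Group G] (K : Subgroup G) (n : ℕ) :
    (derivedSeries K n).map K.subtype = derivedSubgroup^[n] K := by
  induction n with
  | zero => simp [derivedSeries_zero, ← MonoidHom.range_eq_map]
  | succ n ih =>
    rw [derivedSeries_succ, Subgroup.map_commutator, ih, Function.iterate_succ_apply',
      derivedSubgroup]

/-- The number of conjugacy classes contained in `X` and in the coset `P d`. -/
noncomputable def etaCoset {G : Type*} [Group G] (X : Set G) (d : G) (P : Subgroup G) : ℕ :=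
  Set.ncard {C : Set G | ((∃ a : G, C = conjClass a) ∧ C ⊆ X) ∧ ∀ g ∈ C, g * d⁻¹ ∈ P}

lemma etaCoset_le_eta {G : Type*} [Group G] [Finite G] (X : Set G) (d : G) (P : Subgroup G) :
    etaCoset X d P ≤ eta X :=
  (Set.ncard_le_ncard (fun _ h => h.1) (Set.toFinite _)).trans_eq (Nat.card_coe_set_eq _).symm

lemma etaCoset_mono {G : Type*} [Group G] [Finite G] (X : Set G) (d : G) {P T : Subgroup G}
    (h : P ≤ T) : etaCoset X d P ≤ etaCoset X d T :=
  Set.ncard_le_ncard (fun _ hC => ⟨hC.1, fun g hg => h (hC.2 g hg)⟩) (Set.toFinite _)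

lemma mul_inv_mem_of_isConj {G : Type*} [Group G] {d : G} {P : Subgroup G} [P.Normal]
    (hd : ∀ g : G, ⁅g, d⁆ ∈ P) {x y : G} (h : IsConj x y) (hx : x * d⁻¹ ∈ P) : y * d⁻¹ ∈ P := by
  obtain ⟨g, rfl⟩ := isConj_iff.mp h
  have h1 := P.mul_mem (‹P.Normal›.conj_mem _ hx g) (hd g)
  convert h1 using 1
  rw [commutatorElement_def]
  group

lemma etaCoset_lt {G : Type*} [Group G] [Finite G] {X : Set G} {d w : G} {P T : Subgroup G}
    [T.Normal] (h : P ≤ T) (hd : ∀ g : G, ⁅g, d⁆ ∈ T) (hX : conjClass w ⊆ X)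
    (hT : w * d⁻¹ ∈ T) (hP : w * d⁻¹ ∉ P) : etaCoset X d P < etaCoset X d T := by
  refine Set.ncard_lt_ncard ⟨fun _ hC => ⟨hC.1, fun g hg => h (hC.2 g hg)⟩, fun hsub => ?_⟩
    (Set.toFinite _)
  have hmem := hsub (show conjClass w ∈ _ from
    ⟨⟨⟨w, rfl⟩, hX⟩, fun g hg => mul_inv_mem_of_isConj hd hg hT⟩)
  exact hP (hmem.2 w (IsConj.refl w))

lemma conjClass_subset_mul {G : Type*} [Group G] {a b x y : G} (hx : x ∈ conjClass a)
    (hy : y ∈ conjClass b) : conjClass (x * y) ⊆ conjClass a * conjClass b := by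
  intro g hg
  obtain ⟨c, rfl⟩ := isConj_iff.mp hg
  exact ⟨c * x * c⁻¹, IsConj.trans hx (isConj_iff.mpr ⟨c, rfl⟩), c * y * c⁻¹,
    IsConj.trans hy (isConj_iff.mpr ⟨c, rfl⟩), by group⟩

lemma exists_mul_mem_conjClass {G : Type*} [Group G] {a b d x : G}
    (h : conjClass d ⊆ conjClass a * conjClass b) (hx : x ∈ conjClass a) :
    ∃ y ∈ conjClass b, x * y ∈ conjClass d := by
  obtain ⟨x', hx', y', hy', e⟩ := h (IsConj.refl d)
  obtain ⟨c, rfl⟩ := isConj_iff.mp (IsConj.trans (IsConj.symm hx') hx)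
  exact ⟨c * y' * c⁻¹, IsConj.trans hy' (isConj_iff.mpr ⟨c, rfl⟩), isConj_iff.mpr ⟨c, by
    rw [← e]; group⟩⟩

lemma exists_mul_mem_conjClass' {G : Type*} [Group G] {a b d y : G}
    (h : conjClass d ⊆ conjClass a * conjClass b) (hy : y ∈ conjClass b) :
    ∃ x ∈ conjClass a, x * y ∈ conjClass d := by
  obtain ⟨x', hx', y', hy', e⟩ := h (IsConj.refl d)
  obtain ⟨c, rfl⟩ := isConj_iff.mp (IsConj.trans (IsConj.symm hy') hy)
  exact ⟨c * x' * c⁻¹, IsConj.trans hx' (isConj_iff.mpr ⟨c, rfl⟩), isConj_iff.mpr ⟨c, by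
    rw [← e]; group⟩⟩

instance centralizer_conjClass_normal {G : Type*} [Group G] (d : G) :
    (Subgroup.centralizer (conjClass d)).Normal := by
  refine ⟨fun x hx g => ?_⟩
  rw [Subgroup.mem_centralizer_iff] at hx ⊢
  intro y hy
  have h := hx (g⁻¹ * y * g) (IsConj.trans hy (isConj_iff.mpr ⟨g⁻¹, by simp⟩))
  have h' := congrArg (fun z => g * z * g⁻¹) h
  simpa [mul_assoc] using h'

/-- If `G` is a finite supersolvable group and `A`, `B`, `D` are conjugacy
classes of `G` with `D ⊆ AB`, then `C_G(D)/(C_G(A) ∩ C_G(B))` is solvable of derived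
length at most `2·η(AB)`: the `2·η(AB)`-th term of the derived series of `C_G(D)` is
contained in `C_G(A) ∩ C_G(B)`. -/
theorem stmt_2 {G : Type*} [Group G] [Finite G] (hG : IsSupersolvable G)
    (A B D : Set G)
    (hA : ∃ a : G, A = conjClass a)
    (hB : ∃ b : G, B = conjClass b)
    (hD : ∃ d : G, D = conjClass d)
    (hDAB : D ⊆ A * B) :
    Subgroup.map (Subgroup.centralizer D).subtype
        (derivedSeries ↥(Subgroup.centralizer D) (2 * eta (A * B))) ≤
      Subgroup.centralizer A ⊓ Subgroup.centralizer B := by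
  obtain ⟨a, rfl⟩ := hA
  obtain ⟨b, rfl⟩ := hB
  obtain ⟨d, rfl⟩ := hD
  obtain ⟨n, H, h0, hn, hle, hnorm, hcyc⟩ := hG
  set A := conjClass a
  set B := conjClass b
  set K := Subgroup.centralizer (conjClass d)
  have hKn : K.Normal := centralizer_conjClass_normal d
  -- the smallest normal subgroup modulo which `d` is central
  let N : Subgroup G := ⁅(⊤ : Subgroup G), Subgroup.normalClosure {d}⁆
  have hdN : ∀ g : G, ⁅g, d⁆ ∈ N := fun g =>
    Subgroup.commutator_mem_commutator (Subgroup.mem_top g)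
      (Subgroup.subset_normalClosure rfl)
  have hKN : ⁅K, N⁆ ≤ ⊥ := by
    have h1 : Subgroup.normalClosure {d} ≤ Subgroup.centralizer (K : Set G) := by
      refine Subgroup.normalClosure_le_normal ?_
      rw [Set.singleton_subset_iff]
      exact fun k hk => (hk d (IsConj.refl d)).symm
    rw [Subgroup.commutator_comm, le_bot_iff, Subgroup.commutator_eq_bot_iff_le_centralizer]
    exact (Subgroup.commutator_le_right _ _).trans h1
  let P : ℕ → Subgroup G := fun i => H i ⊔ N
  have hPn : ∀ i, (P i).Normal := fun i => Subgroup.sup_normal _ _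
  have hNP : ∀ i, N ≤ P i := fun i => le_sup_right
  have hPle : ∀ i, P i ≤ P (i + 1) := fun i => sup_le_sup_right (hle i) _
  have hP0 : P 0 = N := by simp [P, h0]
  have hcomm : ∀ i, ⁅derivedSubgroup K, P (i + 1)⁆ ≤ P i := by
    intro i
    have := hcyc i inferInstance
    have h1 : ⁅commutator G, H (i + 1)⁆ ≤ H i := commutator_commutator_le_of_isCyclic
    have h2 : derivedSubgroup K ≤ commutator G := Subgroup.commutator_mono le_top le_top
    have : (derivedSubgroup K).Normal := Subgroup.commutator_normal K K
    have h3 : P (i + 1) ≤ centralizerMod (derivedSubgroup K : Set G) (P i) := by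
      refine sup_le (fun s hs => mem_centralizerMod.mpr fun g hg => ?_)
        (fun s hs => mem_centralizerMod.mpr fun g hg => ?_)
      · exact le_sup_left (α := Subgroup G) (h1 (Subgroup.commutator_mem_commutator (h2 hg) hs))
      · exact hNP i (Subgroup.commutator_le_right _ N
          (Subgroup.commutator_mem_commutator hg hs))
    exact Subgroup.commutator_le.mpr fun g hg s hs => mem_centralizerMod.mp (h3 hs) g hg
  have hpos : 1 ≤ etaCoset (A * B) d (P 0) := by
    refine (Set.ncard_pos (Set.toFinite _)).mpr ⟨conjClass d, ⟨⟨d, rfl⟩, hDAB⟩, fun g hg => ?_⟩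
    exact mul_inv_mem_of_isConj (fun g => hNP 0 (hdN g)) hg (by simp)
  have hlt : ∀ i, ¬ K ⊓ centralizerMod A (P (i + 1)) ≤ centralizerMod A (P i) →
      etaCoset (A * B) d (P i) < etaCoset (A * B) d (P (i + 1)) := by
    intro i hi
    obtain ⟨x, ⟨hxK, hx⟩, hx'⟩ := Set.not_subset.mp hi
    replace hx := mem_centralizerMod.mp hx
    rw [SetLike.mem_coe, mem_centralizerMod] at hx'
    push Not at hx'
    obtain ⟨a', ha', hax⟩ := hx'
    obtain ⟨b', hb', hab⟩ := exists_mul_mem_conjClass hDAB ha'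
    have hd' : a' * b' * d⁻¹ ∈ N := mul_inv_mem_of_isConj hdN hab (by simp)
    have e : x * a' * x⁻¹ * b' * d⁻¹ = ⁅a', x⁆⁻¹ * (a' * b' * d⁻¹) := by
      rw [commutatorElement_def]; group
    refine etaCoset_lt (w := x * a' * x⁻¹ * b') (hPle i) (fun g => hNP _ (hdN g))
      (conjClass_subset_mul (IsConj.trans ha' (isConj_iff.mpr ⟨x, rfl⟩)) hb') ?_ ?_
    · rw [e]
      exact mul_mem (inv_mem (hx a' ha')) (hNP _ hd')
    · rwa [e, Subgroup.mul_mem_cancel_right _ (hNP i hd'), inv_mem_iff]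
  have hit : ∀ m (S : Subgroup G), derivedSubgroup^[m] S ≤ S := fun m S =>
    Function.iterate_le_id_of_le_id derivedSubgroup_le m S
  have hind : ∀ i m, etaCoset (A * B) d (P i) ≤ m + 1 →
      derivedSubgroup^[m] (derivedSubgroup K ⊓ centralizerMod A (P i)) ≤
        K ⊓ centralizerMod A (P 0) := by
    intro i
    induction i with
    | zero => exact fun m _ => (hit m _).trans (inf_le_inf_right _ (derivedSubgroup_le K))
    | succ i ih =>
      intro m hm
      by_cases hi : K ⊓ centralizerMod A (P (i + 1)) ≤ centralizerMod A (P i)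
      · refine le_trans ((derivedSubgroup_mono.iterate m) (le_inf inf_le_left ?_))
          (ih m ((etaCoset_mono _ _ (hPle i)).trans hm))
        exact (inf_le_inf_right _ (derivedSubgroup_le K)).trans hi
      · have h1 := hlt i hi
        have h2 := hpos.trans (etaCoset_mono (A * B) d (hP0.trans_le (hNP i)))
        obtain ⟨m, rfl⟩ : ∃ k, m = k + 1 := ⟨m - 1, by omega⟩
        rw [Function.iterate_succ_apply]
        have : (derivedSubgroup K).Normal := Subgroup.commutator_normal K K
        refine le_trans ((derivedSubgroup_mono.iterate m) (le_inf ?_ ?_)) (ih m (by omega))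
        · exact (derivedSubgroup_le _).trans inf_le_left
        · exact commutator_inf_centralizerMod_le A _ _ _ (hcomm i)
  obtain ⟨m, hm⟩ : ∃ m, eta (A * B) = m + 1 :=
    ⟨eta (A * B) - 1, by have := hpos.trans (etaCoset_le_eta _ _ _); omega⟩
  have hm1 : derivedSubgroup^[m + 1] K ≤ K ⊓ centralizerMod A (P 0) := by
    rw [Function.iterate_succ_apply]
    refine le_trans ((derivedSubgroup_mono.iterate m) (le_inf le_rfl fun x _ => ?_))
      (hind n m ((etaCoset_le_eta _ _ _).trans hm.le))
    exact mem_centralizerMod.mpr fun a _ => le_sup_left (α := Subgroup G)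
      (hn.symm ▸ Subgroup.mem_top _)
  have hm2 : derivedSubgroup^[m + 2] K ≤ K ⊓ centralizerMod A ⊥ := by
    rw [Function.iterate_succ_apply']
    refine (derivedSubgroup_mono hm1).trans (le_inf ?_ ?_)
    · exact (derivedSubgroup_le _).trans inf_le_left
    · exact commutator_inf_centralizerMod_le A K (P 0) ⊥ (hP0.symm ▸ hKN)
  rw [map_subtype_derivedSeries, hm, show 2 * (m + 1) = m + (m + 2) by ring,
    Function.iterate_add_apply]
  refine ((hit m _).trans hm2).trans ?_
  rintro x ⟨hxK, hx⟩
  have hxA : ∀ y ∈ A, y * x = x * y := fun y hy =>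
    commutatorElement_eq_one_iff_mul_comm.mp (Subgroup.mem_bot.mp (mem_centralizerMod.mp hx y hy))
  refine ⟨fun y hy => hxA y hy, fun y hy => ?_⟩
  obtain ⟨z, hz, hzy⟩ := exists_mul_mem_conjClass' hDAB hy
  have h1 : Commute (z * y) x := hxK _ hzy
  have h2 : Commute z x := hxA z hz
  simpa using (h2.inv_left.mul_left h1).eq
end

section
/- Let F : ℕ → ℕ be a nondecreasing function and let G be a finite group such that for every normal subgroup M of G and every conjugacy class Ā of the quotient Ḡ = G/M, the group Ḡ/C_Ḡ(Ā) is solvable of derived length at most F(η(Ā·Ā⁻¹)). Let A, B, D be conjugacy classes of G with D ⊆ AB. Then C_G(D)/(C_G(A) ∩ C_G(B)) is solvable of derived length at most 1 + F(η(AB)). -/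
open scoped Pointwise

open scoped commutatorElement

theorem mem_conjClass_self {G : Type*} [Group G] (a : G) : a ∈ conjClass a :=
  IsConj.refl a

theorem conjClass_eq_of_mem {G : Type*} [Group G] {a x : G} (h : x ∈ conjClass a) :
    conjClass a = conjClass x := by
  ext y
  exact ⟨fun hy => (IsConj.symm h).trans hy, fun hy => IsConj.trans h hy⟩

theorem conj_mem_conjClass {G : Type*} [Group G] {a x : G} (g : G) (h : x ∈ conjClass a) :
    g * x * g⁻¹ ∈ conjClass a :=
  IsConj.trans h (isConj_iff.2 ⟨g, rfl⟩)

theorem inv_conjClass {G : Type*} [Group G] (a : G) : (conjClass a)⁻¹ = conjClass a⁻¹ := by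
  ext x
  simp only [Set.mem_inv, conjClass, Set.mem_ofPred_eq, isConj_iff]
  refine exists_congr fun g => ?_
  rw [← inv_inj (a := g * a * g⁻¹)]
  simp [mul_assoc]

theorem image_conjClass {G H : Type*} [Group G] [Group H] (f : G →* H)
    (hf : Function.Surjective f) (a : G) : f '' conjClass a = conjClass (f a) := by
  ext y
  simp only [conjClass, Set.mem_image, Set.mem_ofPred_eq, isConj_iff]
  constructor
  · rintro ⟨_, ⟨g, rfl⟩, rfl⟩
    exact ⟨f g, by simp⟩
  · rintro ⟨h, rfl⟩
    obtain ⟨g, rfl⟩ := hf h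
    exact ⟨_, ⟨g, rfl⟩, by simp⟩

theorem eta_image_le {G H : Type*} [Group G] [Group H] [Finite G] (f : G →* H)
    (hf : Function.Surjective f) (X : Set G) (hX : ∀ g : G, ∀ x ∈ X, g * x * g⁻¹ ∈ X) :
    eta (f '' X) ≤ eta X := by
  let φ : {C : Set G // (∃ a : G, C = conjClass a) ∧ C ⊆ X} →
      {C : Set H // (∃ a : H, C = conjClass a) ∧ C ⊆ f '' X} := fun C =>
    ⟨f '' C.1, C.2.1.elim fun a ha => ⟨f a, by rw [ha, image_conjClass f hf]⟩,
      Set.image_mono C.2.2⟩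
  refine Nat.card_le_card_of_surjective φ ?_
  rintro ⟨_, ⟨c, rfl⟩, hc⟩
  obtain ⟨x, hx, rfl⟩ := hc (mem_conjClass_self c)
  refine ⟨⟨conjClass x, ⟨x, rfl⟩, fun y hy => ?_⟩, Subtype.ext (image_conjClass f hf x)⟩
  obtain ⟨g, rfl⟩ := isConj_iff.1 hy
  exact hX g x hx

/-- If conjugation by `a` multiplies `h` and `k` by commuting factors, each commuting with the other
element, then `a` commutes with the commutator of `h` and `k`. -/
theorem commute_commutatorElement {G : Type*} [Group G] {a h k c c' : G}
    (hh : a * h * a⁻¹ = h * c) (hk : a * k * a⁻¹ = k * c')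
    (ck : Commute c k) (ch' : Commute c' h) (cc : Commute c c') : Commute a ⁅h, k⁆ := by
  have key : a * ⁅h, k⁆ * a⁻¹ = ⁅h, k⁆ := by
    rw [conjugate_commutatorElement, hh, hk, commutatorElement_def, commutatorElement_def]
    have h1 : h * c * (k * c') = h * k * (c * c') := by
      rw [mul_assoc, ← mul_assoc c, ck.eq]; group
    have h2 : k * c' * (h * c) = k * h * (c * c') := by
      rw [mul_assoc, ← mul_assoc c', ch'.eq, cc.eq]; group
    calc h * c * (k * c') * (h * c)⁻¹ * (k * c')⁻¹
        = (h * c * (k * c')) * (k * c' * (h * c))⁻¹ := by group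
      _ = h * k * h⁻¹ * k⁻¹ := by rw [h1, h2]; group
  exact mul_inv_eq_iff_eq_mul.1 key

/-- Let `F : ℕ → ℕ` be nondecreasing, and suppose that for every normal
subgroup `M` of the finite group `G` and every conjugacy class `Ā` of `Ḡ = G/M`, the
group `Ḡ/C_Ḡ(Ā)` is solvable of derived length at most `F(η(Ā·Ā⁻¹))` (i.e. the
`F(η(Ā·Ā⁻¹))`-th derived subgroup of `Ḡ` is contained in `C_Ḡ(Ā)`).  If `A`, `B`, `D`
are conjugacy classes of `G` with `D ⊆ AB`, then `C_G(D)/(C_G(A) ∩ C_G(B))` is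
solvable of derived length at most `1 + F(η(AB))`: the `(1 + F(η(AB)))`-th term of the
derived series of `C_G(D)` is contained in `C_G(A) ∩ C_G(B)`. -/
theorem stmt_3 {G : Type*} [Group G] [Finite G] (F : ℕ → ℕ) (hF : Monotone F)
    (hgood : ∀ (M : Subgroup G), ∀ _ : M.Normal, ∀ abar : G ⧸ M,
      derivedSeries (G ⧸ M) (F (eta (conjClass abar * (conjClass abar)⁻¹))) ≤
        Subgroup.centralizer (conjClass abar))
    (A B D : Set G)
    (hA : ∃ a : G, A = conjClass a)
    (hB : ∃ b : G, B = conjClass b)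
    (hD : ∃ d : G, D = conjClass d)
    (hDAB : D ⊆ A * B) :
    Subgroup.map (Subgroup.centralizer D).subtype
        (derivedSeries ↥(Subgroup.centralizer D) (1 + F (eta (A * B)))) ≤
      Subgroup.centralizer A ⊓ Subgroup.centralizer B := by
  obtain ⟨a₀, rfl⟩ := hA
  obtain ⟨b₀, rfl⟩ := hB
  obtain ⟨d, rfl⟩ := hD
  obtain ⟨a, ha, b, hb, hab⟩ := Set.mem_mul.1 (hDAB (mem_conjClass_self d))
  rw [conjClass_eq_of_mem ha, conjClass_eq_of_mem hb]
  rw [conjClass_eq_of_mem ha, conjClass_eq_of_mem hb] at hDAB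
  clear ha hb a₀ b₀
  set n := F (eta (conjClass a * conjClass b)) with hn
  set K := Subgroup.centralizer (conjClass d) with hK
  set M := Subgroup.normalClosure (conjClass d) with hM
  have hdM : d ∈ M := Subgroup.subset_normalClosure (mem_conjClass_self d)
  have hMK : ∀ m ∈ M, ∀ k ∈ K, Commute m k := by
    have hle : M ≤ Subgroup.centralizer (K : Set G) := by
      rw [hM, Subgroup.normalClosure, Subgroup.closure_le]
      intro x hx
      have hx' : x ∈ conjClass d := by
        obtain ⟨y, hy, hyx⟩ := Group.mem_conjugatesOfSet_iff.1 hx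
        exact IsConj.trans hy hyx
      exact Subgroup.mem_centralizer_iff.2 fun k hk =>
        (Subgroup.mem_centralizer_iff.1 hk x hx').symm
    intro m hm k hk
    exact (Subgroup.mem_centralizer_iff.1 (hle hm) k hk).symm
  have hKn : ∀ g : G, ∀ k ∈ K, g * k * g⁻¹ ∈ K := by
    intro g k hk
    refine Subgroup.mem_centralizer_iff.2 fun x hx => ?_
    have := Subgroup.mem_centralizer_iff.1 hk _ (conj_mem_conjClass g⁻¹ hx)
    rw [inv_inv] at this
    calc x * (g * k * g⁻¹) = g * (g⁻¹ * x * g * k) * g⁻¹ := by group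
      _ = g * (k * (g⁻¹ * x * g)) * g⁻¹ := by rw [this]
      _ = g * k * g⁻¹ * x := by group
  have hsurj : Function.Surjective (QuotientGroup.mk' M) := QuotientGroup.mk'_surjective M
  have hb : QuotientGroup.mk' M b = (QuotientGroup.mk' M a)⁻¹ := by
    refine eq_inv_of_mul_eq_one_right ?_
    rw [← map_mul, hab]
    exact (QuotientGroup.eq_one_iff d).2 hdM
  have heta : eta (conjClass (QuotientGroup.mk' M a) * (conjClass (QuotientGroup.mk' M a))⁻¹) ≤
      eta (conjClass a * conjClass b) := by
    rw [inv_conjClass, ← hb, ← image_conjClass _ hsurj, ← image_conjClass _ hsurj,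
      ← Set.image_mul]
    refine eta_image_le _ hsurj _ ?_
    rintro g _ ⟨x, hx, y, hy, rfl⟩
    exact ⟨_, conj_mem_conjClass g hx, _, conj_mem_conjClass g hy, by group⟩
  have hcomm : ∀ h ∈ derivedSeries G n, ∀ x ∈ conjClass a, h⁻¹ * (x * h * x⁻¹) ∈ M := by
    intro h hh x hx
    have h1 : QuotientGroup.mk' M h ∈ derivedSeries (G ⧸ M) n :=
      map_derivedSeries_le_derivedSeries (QuotientGroup.mk' M) n (Subgroup.mem_map_of_mem _ hh)
    have h2 := hgood M inferInstance (QuotientGroup.mk' M a)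
      (derivedSeries_antitone _ (hF heta) h1)
    have h3 := Subgroup.mem_centralizer_iff.1 h2 (QuotientGroup.mk' M x)
      (by rw [← image_conjClass _ hsurj]; exact Set.mem_image_of_mem _ hx)
    rw [← QuotientGroup.eq_one_iff]
    change QuotientGroup.mk' M _ = 1
    rw [map_mul, map_mul, map_mul, h3, map_inv, map_inv]
    group
  have hcA : ∀ h ∈ (derivedSeries K (1 + n)).map K.subtype, ∀ x ∈ conjClass a, Commute x h := by
    intro h hh x hx
    suffices h ∈ Subgroup.centralizer {x} from
      Subgroup.mem_centralizer_iff.1 this x rfl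
    revert h
    change (derivedSeries K (1 + n)).map K.subtype ≤ Subgroup.centralizer {x}
    rw [add_comm, derivedSeries_succ, Subgroup.map_commutator, Subgroup.commutator_le]
    have hle : (derivedSeries K n).map K.subtype ≤ derivedSeries G n :=
      map_derivedSeries_le_derivedSeries K.subtype n
    have hKle : (derivedSeries K n).map K.subtype ≤ K := Subgroup.map_subtype_le _
    intro h hh k hk
    refine Subgroup.mem_centralizer_iff.2 ?_
    rintro y hy
    rw [Set.mem_singleton_iff.1 hy]
    have hc := hcomm h (hle hh) x hx
    have hc' := hcomm k (hle hk) x hx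
    refine commute_commutatorElement (mul_inv_cancel_left h _).symm (mul_inv_cancel_left k _).symm
      (hMK _ hc _ (hKle hk)) (hMK _ hc' _ (hKle hh)) (hMK _ hc _ ?_)
    exact K.mul_mem (K.inv_mem (hKle hk)) (hKn x k (hKle hk))
  refine le_inf (fun h hh => Subgroup.mem_centralizer_iff.2 fun x hx => hcA h hh x hx)
    (fun h hh => Subgroup.mem_centralizer_iff.2 fun y hy => ?_)
  obtain ⟨g, rfl⟩ := isConj_iff.1 hy
  have hy' : g * b * g⁻¹ = (g * a * g⁻¹)⁻¹ * (g * d * g⁻¹) := by rw [← hab]; group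
  rw [hy']
  have hhK : h ∈ K := Subgroup.map_subtype_le _ hh
  exact (hcA h hh _ (conj_mem_conjClass g (mem_conjClass_self a))).inv_left.mul_left
    (Subgroup.mem_centralizer_iff.1 hhK _ (conj_mem_conjClass g (mem_conjClass_self d)))
end

section
/- For every positive integer m there exist a finite nilpotent group G and conjugacy classes A, B, D of G such that AB = D and the quotient group C_G(D)/(C_G(A) ∩ C_G(B)) has order exactly m. -/
open scoped Pointwise

/-- The Heisenberg group over a ring `R`, with coordinates `x`, `y` modulo the centre and
central coordinate `z`. -/
@[ext]
structure HeisenbergGroup (R : Type) where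
  x : R
  y : R
  z : R

namespace HeisenbergGroup

variable {R : Type} [CommRing R]

instance : Mul (HeisenbergGroup R) :=
  ⟨fun g h => ⟨g.x + h.x, g.y + h.y, g.z + h.z + g.x * h.y⟩⟩

instance : One (HeisenbergGroup R) := ⟨⟨0, 0, 0⟩⟩

instance : Inv (HeisenbergGroup R) := ⟨fun g => ⟨-g.x, -g.y, -g.z + g.x * g.y⟩⟩

@[simp] theorem mul_x (g h : HeisenbergGroup R) : (g * h).x = g.x + h.x := rfl
@[simp] theorem mul_y (g h : HeisenbergGroup R) : (g * h).y = g.y + h.y := rfl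
@[simp] theorem mul_z (g h : HeisenbergGroup R) :
    (g * h).z = g.z + h.z + g.x * h.y := rfl
@[simp] theorem one_x : (1 : HeisenbergGroup R).x = 0 := rfl
@[simp] theorem one_y : (1 : HeisenbergGroup R).y = 0 := rfl
@[simp] theorem one_z : (1 : HeisenbergGroup R).z = 0 := rfl
@[simp] theorem inv_x (g : HeisenbergGroup R) : g⁻¹.x = -g.x := rfl
@[simp] theorem inv_y (g : HeisenbergGroup R) : g⁻¹.y = -g.y := rfl
@[simp] theorem inv_z (g : HeisenbergGroup R) : g⁻¹.z = -g.z + g.x * g.y := rfl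

instance : Group (HeisenbergGroup R) :=
  Group.ofLeftAxioms
    (fun g h k => by ext <;> simp <;> ring)
    (fun g => by ext <;> simp)
    (fun g => by ext <;> simp)

instance [Finite R] : Finite (HeisenbergGroup R) :=
  Finite.of_injective (fun g : HeisenbergGroup R => (g.x, g.y, g.z)) fun g h e => by
    simp only [Prod.mk.injEq] at e
    exact HeisenbergGroup.ext e.1 e.2.1 e.2.2

theorem mul_comm_iff (g h : HeisenbergGroup R) : g * h = h * g ↔ g.x * h.y = h.x * g.y := by
  constructor
  · intro e
    have e' := congrArg HeisenbergGroup.z e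
    simp only [mul_z] at e'
    linear_combination e'
  · intro e
    ext
    · simp [add_comm]
    · simp [add_comm]
    · simp only [mul_z]
      linear_combination e

/-- The first coordinate as a homomorphism. -/
def xHom : HeisenbergGroup R →* Multiplicative R where
  toFun g := Multiplicative.ofAdd g.x
  map_one' := rfl
  map_mul' _ _ := rfl

/-- Reduction modulo the central coordinate. -/
def xyHom : HeisenbergGroup R →* Multiplicative (R × R) where
  toFun g := Multiplicative.ofAdd (g.x, g.y)
  map_one' := rfl
  map_mul' _ _ := rfl

theorem ker_xyHom_le_center :
    (xyHom : HeisenbergGroup R →* _).ker ≤ Subgroup.center (HeisenbergGroup R) := by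
  intro g hg
  obtain ⟨hx, hy⟩ : g.x = 0 ∧ g.y = 0 := Prod.mk.inj (Multiplicative.ofAdd.injective hg)
  refine Subgroup.mem_center_iff.mpr fun h => ?_
  rw [mul_comm_iff, hx, hy, mul_zero, zero_mul]

instance : Group.IsNilpotent (HeisenbergGroup R) :=
  Subgroup.isNilpotent_of_ker_le_center xyHom ker_xyHom_le_center

/-- If `r * g.x + s * g.y = 1`, the class of `g` is its full coset modulo the centre. -/
theorem isConj_iff_of_unimodular {g : HeisenbergGroup R} {r s : R}
    (hg : r * g.x + s * g.y = 1) (h : HeisenbergGroup R) :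
    IsConj g h ↔ h.x = g.x ∧ h.y = g.y := by
  rw [isConj_iff]
  constructor
  · rintro ⟨c, rfl⟩
    simp
  · rintro ⟨hx, hy⟩
    refine ⟨⟨(h.z - g.z) * s, -((h.z - g.z) * r), 0⟩, ?_⟩
    rw [mul_inv_eq_iff_eq_mul]
    ext
    · simp [hx, add_comm]
    · simp [hy, add_comm]
    · simp only [mul_z, hx]
      linear_combination (h.z - g.z) * hg

theorem mem_centralizer_iff_of_unimodular {g : HeisenbergGroup R} {r s : R}
    (hg : r * g.x + s * g.y = 1) (h : HeisenbergGroup R) :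
    h ∈ Subgroup.centralizer {k : HeisenbergGroup R | IsConj g k} ↔ g.x * h.y = h.x * g.y := by
  simp only [Subgroup.mem_centralizer_iff, Set.mem_ofPred_eq, isConj_iff_of_unimodular hg,
    mul_comm_iff]
  exact ⟨fun e => e g ⟨rfl, rfl⟩, fun e k hk => by rw [hk.1, hk.2, e]⟩

end HeisenbergGroup

/-- For every positive integer `m` there exist a finite nilpotent group `G`
and conjugacy classes `A`, `B`, `D` of `G` with `AB = D` such that the quotient
`C_G(D)/(C_G(A) ∩ C_G(B))` has order exactly `m`. -/
theorem stmt_4 (m : ℕ) (hm : 0 < m) :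
    ∃ (G : Type) (_ : Group G) (_ : Finite G) (_ : Group.IsNilpotent G)
      (a b d : G),
      {x : G | IsConj a x} * {x : G | IsConj b x} = {x : G | IsConj d x} ∧
      ∃ _ : ((Subgroup.centralizer {x : G | IsConj a x} ⊓
            Subgroup.centralizer {x : G | IsConj b x}).subgroupOf
          (Subgroup.centralizer {x : G | IsConj d x})).Normal,
        Nat.card (↥(Subgroup.centralizer {x : G | IsConj d x}) ⧸
          ((Subgroup.centralizer {x : G | IsConj a x} ⊓
              Subgroup.centralizer {x : G | IsConj b x}).subgroupOf
            (Subgroup.centralizer {x : G | IsConj d x}))) = m := by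
  have : NeZero m := ⟨hm.ne'⟩
  let a : HeisenbergGroup (ZMod m) := ⟨1, 0, 0⟩
  let b : HeisenbergGroup (ZMod m) := ⟨0, 1, 0⟩
  let d : HeisenbergGroup (ZMod m) := ⟨1, 1, 0⟩
  have ha : 1 * a.x + 0 * a.y = 1 := by simp [a]
  have hb : 0 * b.x + 1 * b.y = 1 := by simp [b]
  have hd : 1 * d.x + 0 * d.y = 1 := by simp [d]
  refine ⟨HeisenbergGroup (ZMod m), inferInstance, inferInstance, inferInstance, a, b, d, ?_, ?_⟩
  · ext g
    simp only [Set.mem_mul, Set.mem_ofPred_eq, HeisenbergGroup.isConj_iff_of_unimodular ha,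
      HeisenbergGroup.isConj_iff_of_unimodular hb, HeisenbergGroup.isConj_iff_of_unimodular hd]
    constructor
    · rintro ⟨u, ⟨hu, hu'⟩, v, ⟨hv, hv'⟩, rfl⟩
      simp [hu, hu', hv, hv', a, b, d]
    · rintro ⟨hx, hy⟩
      refine ⟨a, ⟨rfl, rfl⟩, ⟨0, 1, g.z - 1⟩, ⟨rfl, rfl⟩, ?_⟩
      ext <;> simp [hx, hy, a, d]
  · let f := (HeisenbergGroup.xHom (R := ZMod m)).comp
      (Subgroup.centralizer {x : HeisenbergGroup (ZMod m) | IsConj d x}).subtype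
    have hf : Function.Surjective f := fun t =>
      ⟨⟨⟨t.toAdd, t.toAdd, 0⟩,
        (HeisenbergGroup.mem_centralizer_iff_of_unimodular hd _).mpr (by simp [d])⟩, rfl⟩
    have hker : (Subgroup.centralizer {x | IsConj a x} ⊓
        Subgroup.centralizer {x | IsConj b x}).subgroupOf
          (Subgroup.centralizer {x | IsConj d x}) = f.ker := by
      ext ⟨g, hg⟩
      have hxy : g.y = g.x := by
        simpa [d] using (HeisenbergGroup.mem_centralizer_iff_of_unimodular hd g).mp hg
      have hfg : f ⟨g, hg⟩ = 1 ↔ g.x = 0 := Iff.rfl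
      rw [MonoidHom.mem_ker, hfg, Subgroup.mem_subgroupOf, Subgroup.mem_inf,
        HeisenbergGroup.mem_centralizer_iff_of_unimodular ha,
        HeisenbergGroup.mem_centralizer_iff_of_unimodular hb]
      simp [a, b, hxy, eq_comm]
    rw [hker]
    refine ⟨inferInstance, ?_⟩
    rw [Nat.card_congr (QuotientGroup.quotientKerEquivOfSurjective f hf).toEquiv]
    exact (Nat.card_congr Multiplicative.toAdd).trans (Nat.card_zmod m)
end

section
/- Let G be a finite group, let D ⊆ AB where A, B, D are conjugacy classes of G, let N = C_G(D) and C = C_G(N). Then C is a normal subgroup of G, the images Ā and B̄ of A and B in Ḡ = G/C are conjugacy classes of Ḡ whose product Ā·B̄ contains the identity, and consequently B̄ = Ā⁻¹. -/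
open scoped Pointwise

/-- The centralizer of a set closed under conjugation is normal. -/
theorem Subgroup.centralizer_normal_of_conj_mem_s10 {G : Type*} [Group G] {S : Set G}
    (hS : ∀ s ∈ S, ∀ g : G, g * s * g⁻¹ ∈ S) : (Subgroup.centralizer S).Normal := by
  refine ⟨fun n hn g => ?_⟩
  rw [Subgroup.mem_centralizer_iff] at hn ⊢
  intro s hs
  have h := hn (g⁻¹ * s * g) (by simpa using hS s hs g⁻¹)
  calc s * (g * n * g⁻¹) = g * ((g⁻¹ * s * g) * n) * g⁻¹ := by group
    _ = g * n * g⁻¹ * s := by rw [h]; group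

/-- The image of a conjugacy class in a quotient is a conjugacy class. -/
theorem QuotientGroup.image_mk_setOf_isConj {G : Type*} [Group G] (K : Subgroup G) [K.Normal]
    (a : G) : (QuotientGroup.mk '' {x | IsConj a x} : Set (G ⧸ K)) =
      {x | IsConj (a : G ⧸ K) x} := by
  ext x
  constructor
  · rintro ⟨y, hy, rfl⟩
    exact (QuotientGroup.mk' K).map_isConj hy
  · intro hx
    obtain ⟨c, rfl⟩ := isConj_iff.1 hx
    obtain ⟨g, rfl⟩ := QuotientGroup.mk_surjective c
    exact ⟨g * a * g⁻¹, isConj_iff.2 ⟨g, rfl⟩, rfl⟩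

theorem IsConj.inv {G : Type*} [Group G] {a b : G} (h : IsConj a b) : IsConj a⁻¹ b⁻¹ := by
  obtain ⟨c, rfl⟩ := isConj_iff.1 h
  exact isConj_iff.2 ⟨c, by group⟩

/-- Two conjugacy classes whose product contains the identity are inverse to each other. -/
theorem setOf_isConj_eq_inv_of_one_mem_mul {G : Type*} [Group G] {a b : G}
    (h : (1 : G) ∈ {x | IsConj a x} * {x | IsConj b x}) :
    {x | IsConj b x} = {x | IsConj a x}⁻¹ := by
  obtain ⟨x, hx, y, hy, hxy⟩ := Set.mem_mul.1 h
  obtain rfl : y = x⁻¹ := (inv_eq_of_mul_eq_one_right hxy).symm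
  have hab : IsConj a b⁻¹ := hx.trans (by simpa using hy.symm.inv)
  ext z
  refine ⟨fun hz => hab.trans hz.inv, fun hz => ?_⟩
  simpa using hab.symm.inv.trans hz.inv

/-- Let `G` be a finite group, `A`, `B`, `D` conjugacy classes of `G` with
`D ⊆ AB`; set `N = C_G(D)` and `C = C_G(N)`.  Then `C ⊴ G`, the images `Ā`, `B̄` of
`A`, `B` in `Ḡ = G/C` are conjugacy classes of `Ḡ` whose product contains the
identity, and consequently `B̄ = Ā⁻¹`. -/
theorem stmt_10 {G : Type*} [Group G] [Finite G] (A B D : Set G)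
    (hA : ∃ a : G, A = {x | IsConj a x})
    (hB : ∃ b : G, B = {x | IsConj b x})
    (hD : ∃ d : G, D = {x | IsConj d x})
    (hDAB : D ⊆ A * B) :
    ∃ _ : (Subgroup.centralizer
        ((Subgroup.centralizer D : Subgroup G) : Set G)).Normal,
      (∃ abar : G ⧸ Subgroup.centralizer ((Subgroup.centralizer D : Subgroup G) : Set G),
        (QuotientGroup.mk '' A :
            Set (G ⧸ Subgroup.centralizer ((Subgroup.centralizer D : Subgroup G) : Set G)))
          = {x | IsConj abar x}) ∧
      (∃ bbar : G ⧸ Subgroup.centralizer ((Subgroup.centralizer D : Subgroup G) : Set G),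
        (QuotientGroup.mk '' B :
            Set (G ⧸ Subgroup.centralizer ((Subgroup.centralizer D : Subgroup G) : Set G)))
          = {x | IsConj bbar x}) ∧
      (1 : G ⧸ Subgroup.centralizer ((Subgroup.centralizer D : Subgroup G) : Set G)) ∈
        ((QuotientGroup.mk '' A) * (QuotientGroup.mk '' B) :
          Set (G ⧸ Subgroup.centralizer ((Subgroup.centralizer D : Subgroup G) : Set G))) ∧
      (QuotientGroup.mk '' B :
          Set (G ⧸ Subgroup.centralizer ((Subgroup.centralizer D : Subgroup G) : Set G)))
        = (QuotientGroup.mk '' A)⁻¹ := by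
  obtain ⟨a, rfl⟩ := hA
  obtain ⟨b, rfl⟩ := hB
  obtain ⟨d, rfl⟩ := hD
  have hN : (Subgroup.centralizer {x | IsConj d x}).Normal :=
    Subgroup.centralizer_normal_of_conj_mem_s10 fun s hs g =>
      IsConj.trans hs (isConj_iff.2 ⟨g, rfl⟩)
  have hC := Subgroup.normal_centralizer (H := Subgroup.centralizer {x | IsConj d x})
  have h_one : (1 : G ⧸ Subgroup.centralizer
        ((Subgroup.centralizer {x | IsConj d x} : Subgroup G) : Set G)) ∈
      ((QuotientGroup.mk '' {x | IsConj a x}) * (QuotientGroup.mk '' {x | IsConj b x}) :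
        Set (G ⧸ Subgroup.centralizer
          ((Subgroup.centralizer {x | IsConj d x} : Subgroup G) : Set G))) := by
    obtain ⟨x, hx, y, hy, hxy⟩ := Set.mem_mul.1 (hDAB (IsConj.refl d))
    refine ⟨_, ⟨x, hx, rfl⟩, _, ⟨y, hy, rfl⟩, ?_⟩
    have hd : d ∈ Subgroup.centralizer
        ((Subgroup.centralizer {x | IsConj d x} : Subgroup G) : Set G) :=
      Subgroup.mem_centralizer_iff.2 fun n hn =>
        (Subgroup.mem_centralizer_iff.1 hn d (IsConj.refl d)).symm
    exact (QuotientGroup.eq_one_iff (x * y)).2 (hxy ▸ hd)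
  refine ⟨hC, ⟨a, QuotientGroup.image_mk_setOf_isConj _ a⟩,
    ⟨b, QuotientGroup.image_mk_setOf_isConj _ b⟩, h_one, ?_⟩
  rw [QuotientGroup.image_mk_setOf_isConj, QuotientGroup.image_mk_setOf_isConj] at h_one ⊢
  exact setOf_isConj_eq_inv_of_one_mem_mul h_one
end
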